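/- Let X be an infinite set of cardinality κ = ℵ_α and let λ = max(|α|, ℵ₀). Then the number of submonoids of the full transformation monoid O^(1) containing all permutations of X is at most 2^(2^λ). -/

import Mathlib

open Cardinal

universe u

/-- The submonoid of all permutations inside the full transformation monoid `Function.End X`. -/
def permSubmonoid (X : Type u) : Submonoid (Function.End X) where
  carrier := {f | Function.Bijective f}
  mul_mem' hf hg := hf.comp hg
  one_mem' := Function.bijective_id

/-- A submonoid `C ≠ O⁽¹⁾` is precomplete iff together with any function outside of it,
it generates the full transformation monoid. -/
def Precomplete {X : Type u} (C : Submonoid (Function.End X)) : Prop :=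
  C ≠ ⊤ ∧ ∀ f : Function.End X, f ∉ C →
    Submonoid.closure ((C : Set (Function.End X)) ∪ {f}) = ⊤

/-- `f` is `ξ`-injective: `f` is injective off a set of cardinality `< ξ`. -/
def XiInjective {X : Type u} (ξ : Cardinal.{u}) (f : Function.End X) : Prop :=
  ∃ Y : Set X, #Y < ξ ∧ Set.InjOn f Yᶜ

/-- `f` is `ξ`-surjective: the complement of its range has cardinality `< ξ`. -/
def XiSurjective {X : Type u} (ξ : Cardinal.{u}) (f : Function.End X) : Prop :=
  #((Set.range f)ᶜ : Set X) < ξ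

/-- The set `A` of functions almost all of whose fibers are small. -/
def monA (X : Type u) : Set (Function.End X) :=
  {f | #{y : X | ¬ #(f ⁻¹' {y}) < #X} < #X}

/-- The set `A'` of functions `f` such that for some `ξ < |X|`, almost all fibers of `f`
have cardinality at most `ξ`. -/
def monA' (X : Type u) : Set (Function.End X) :=
  {f | ∃ ξ : Cardinal.{u}, ξ < #X ∧ #{x : X | ¬ #(f ⁻¹' {x}) ≤ ξ} < #X}

/-- The set `G_ξ` of functions which are `ξ`-injective or not `ξ`-surjective. -/
def monG (X : Type u) (ξ : Cardinal.{u}) : Set (Function.End X) :=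
  {f | XiInjective ξ f ∨ ¬ XiSurjective ξ f}

/-- The set `M_ξ` of functions which are `ξ`-surjective or not `ξ`-injective. -/
def monM (X : Type u) (ξ : Cardinal.{u}) : Set (Function.End X) :=
  {f | XiSurjective ξ f ∨ ¬ XiInjective ξ f}

/-- The kernel sequence of `f` assigns to every cardinal `ξ` the number of
(nonempty) fibers of `f` of cardinality `ξ`. -/
noncomputable def kernelSeq {X : Type u} (f : X → X) (ξ : Cardinal.{u}) : Cardinal.{u} :=
  #{A : Set X // (∃ y : X, A = f ⁻¹' {y}) ∧ A.Nonempty ∧ #A = ξ}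

/-- The set `R`: the range of the sequence `(n i)` together with all infinite
successor cardinals `≤ κ`. -/
def setR (κ : Cardinal.{u}) (n : ℕ → ℕ) : Set Cardinal.{u} :=
  (Set.range fun i : ℕ => (n i : Cardinal.{u})) ∪
    {ξ | ℵ₀ ≤ ξ ∧ ξ ≤ κ ∧ ∃ μ : Cardinal.{u}, ξ = Order.succ μ}

/-- The sum of a set of cardinals. -/
noncomputable def setSum (A : Set Cardinal.{u}) : Cardinal.{u + 1} :=
  Cardinal.sum fun η : A => (η : Cardinal.{u})

/-- Two functions whose fibers over each point have equal cardinalities differ by a permutation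
of their domains. -/
theorem exists_equiv_of_mk_fiber_eq {A B : Type u} {C : Type*} {f : A → C} {g : B → C}
    (h : ∀ c, #{a // f a = c} = #{b // g b = c}) : ∃ e : A ≃ B, ∀ a, g (e a) = f a := by
  let e (c : C) : {a // f a = c} ≃ {b // g b = c} := (Cardinal.eq.1 (h c)).some
  exact ⟨Equiv.ofFiberEquiv e, Equiv.ofFiberEquiv_map e⟩

/-- The number of points whose fiber under `f` has cardinality `ξ`. -/
noncomputable def fiberCount {X : Type u} (f : X → X) (ξ : Cardinal.{u}) : Cardinal.{u} :=
  #{y : X // #{x // f x = y} = ξ}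

theorem fiberCount_le {X : Type u} (f : X → X) (ξ : Cardinal.{u}) : fiberCount f ξ ≤ #X :=
  Cardinal.mk_subtype_le _

/-- Functions with the same number of fibers of each size are equivalent under composition with
permutations on both sides. -/
theorem exists_perm_of_fiberCount_eq {X : Type u} {f g : X → X}
    (h : ∀ ξ ≤ #X, fiberCount f ξ = fiberCount g ξ) :
    ∃ σ τ : Equiv.Perm X, g = σ ∘ f ∘ τ := by
  have key : ∀ ξ, #{y : X // #{x // f x = y} = ξ} = #{y : X // #{x // g x = y} = ξ} := by
    intro ξ
    by_cases hξ : ξ ≤ #X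
    · exact h ξ hξ
    · have aux (k : X → X) : IsEmpty {y : X // #{x // k x = y} = ξ} :=
        ⟨fun y => hξ (y.2 ▸ Cardinal.mk_subtype_le _)⟩
      have := aux f
      have := aux g
      simp only [Cardinal.mk_eq_zero]
  obtain ⟨σ, hσ⟩ := exists_equiv_of_mk_fiber_eq key
  obtain ⟨τ, hτ⟩ : ∃ τ : X ≃ X, ∀ x, g (τ x) = σ (f x) := by
    refine exists_equiv_of_mk_fiber_eq (f := fun x => σ (f x)) fun y => ?_
    have := hσ (σ.symm y)
    rw [Equiv.apply_symm_apply] at this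
    rw [this]
    exact Cardinal.mk_congr (Equiv.subtypeEquivRight fun x => (σ.eq_symm_apply).symm)
  refine ⟨σ, τ.symm, funext fun x => ?_⟩
  simpa using hτ (τ.symm x)

theorem mem_of_fiberCount_eq {X : Type u} {M : Submonoid (Function.End X)}
    (hM : permSubmonoid X ≤ M) {f g : Function.End X} (hf : f ∈ M)
    (h : ∀ ξ ≤ #X, fiberCount f ξ = fiberCount g ξ) : g ∈ M := by
  obtain ⟨σ, τ, rfl⟩ := exists_perm_of_fiberCount_eq h
  have hp (ρ : Equiv.Perm X) : (⇑ρ : X → X) ∈ M :=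
    hM (show Function.Bijective ρ from ρ.bijective)
  exact M.mul_mem (hp σ) (M.mul_mem hf (hp τ))

/-- The cardinals up to `ℵ_ α` are enumerated by a type of cardinality at most
`max α.card ℵ₀`. -/
theorem exists_equiv_Iic_aleph (α : Ordinal.{u}) :
    ∃ T : Type u, #T = max α.card ℵ₀ ∧ Nonempty (T ≃ Set.Iic (ℵ_ α : Cardinal.{u})) := by
  refine ⟨(Ordinal.omega0 + α + 1).ToType, ?_, ?_⟩
  · rw [Cardinal.mk_toType, Ordinal.card_add, Ordinal.card_add, Ordinal.card_omega0,
      Ordinal.card_one, Cardinal.add_one_eq (by simp), Cardinal.add_eq_max le_rfl, max_comm]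
  · have e : Set.Iio (Ordinal.omega0 + α + 1) ≃ Set.Iic (ℵ_ α : Cardinal.{u}) :=
      Cardinal.preAleph.toEquiv.subtypeEquiv fun o => by
        simp [Cardinal.aleph_eq_preAleph, Order.lt_add_one_iff]
    exact ⟨Ordinal.ToType.mk.symm.toEquiv.trans e⟩

/-- On an infinite set of cardinality `ℵ_α`, there are at most `2^(2^λ)` submonoids of the
full transformation monoid containing all permutations, where `λ = max(|α|, ℵ₀)`. -/
theorem card_monoids_above_S_le {X : Type u} [Infinite X] {α : Ordinal.{u}}
    (hκ : #X = Cardinal.aleph α) (lam : Cardinal.{u}) (hlam : lam = max α.card ℵ₀) :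
    #{M : Submonoid (Function.End X) // permSubmonoid X ≤ M} ≤ (2 : Cardinal.{u}) ^ ((2 : Cardinal.{u}) ^ lam) := by
  subst hlam
  obtain ⟨T, hT, ⟨e⟩⟩ := exists_equiv_Iic_aleph α
  rw [← hκ] at e
  let code (f : Function.End X) : T → T := fun t => e.symm ⟨fiberCount f (e t), fiberCount_le f _⟩
  have hcode {f g : Function.End X} (h : code f = code g) (ξ : Cardinal.{u}) (hξ : ξ ≤ #X) :
      fiberCount f ξ = fiberCount g ξ := by
    simpa [code] using congrFun h (e.symm ⟨ξ, hξ⟩)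
  have hle {M N : Submonoid (Function.End X)} (hN : permSubmonoid X ≤ N)
      (h : code '' M = code '' N) : M ≤ N := by
    intro f hf
    obtain ⟨g, hg, hgf⟩ : code f ∈ code '' (N : Set (Function.End X)) := h ▸ ⟨f, hf, rfl⟩
    exact mem_of_fiberCount_eq hN hg (hcode hgf)
  have hinj : Function.Injective fun M : {M : Submonoid (Function.End X) // permSubmonoid X ≤ M} =>
      code '' (M : Set (Function.End X)) :=
    fun M N h => Subtype.ext (le_antisymm (hle N.2 h) (hle M.2 h.symm))
  refine (Cardinal.mk_le_of_injective hinj).trans_eq ?_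
  rw [Cardinal.mk_set, ← Cardinal.power_def, hT, Cardinal.power_self_eq (le_max_right _ _)]
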